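/- arXiv:2201.01101 — 2 statements merged into one kernel-verified Lean document; each statement's English description precedes it below -/
import Mathlib

section
/- For every even integer k ≥ 6 there exists a generalized Bethe tree with k levels that has fewer than k main eigenvalues (indeed, at most k−1 main eigenvalues); hence the conjecture that every generalized Bethe tree with an even number k of levels has exactly k main eigenvalues is false for every even k ≥ 6. -/
open Matrix Finset

/-- `G` is a generalized Bethe tree `B(d₁, …, d_{k-1})` with `k` levels and root `r`:
it is a tree, each `dᵢ ≥ 2`, every vertex at distance `i - 1` from `r` has degree `dᵢ`
(for `1 ≤ i ≤ k - 1`), every vertex at distance `k - 1` from `r` has degree `1`, and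
every vertex is at distance at most `k - 1` from `r`. -/
def IsGenBetheTree {V : Type*} (G : SimpleGraph V) (r : V) (k : ℕ) (d : ℕ → ℕ) : Prop :=
  G.IsTree ∧
  (∀ i, 1 ≤ i → i ≤ k - 1 → 2 ≤ d i) ∧
  (∀ i, 1 ≤ i → i ≤ k - 1 → ∀ v, G.dist r v = i - 1 → (G.neighborSet v).ncard = d i) ∧
  (∀ v : V, G.dist r v = k - 1 → (G.neighborSet v).ncard = 1) ∧
  (∀ v : V, G.dist r v ≤ k - 1)

open scoped Classical in
/-- The adjacency matrix of `G` over `ℝ`. -/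
noncomputable def adjMat {V : Type*} [Fintype V] (G : SimpleGraph V) : Matrix V V ℝ :=
  Matrix.of fun v w => if G.Adj v w then (1 : ℝ) else 0

/-- The set of main eigenvalues of `G`: those `λ` admitting a real eigenvector of the
adjacency matrix whose entry sum is nonzero. -/
noncomputable def mainSpectrum {V : Type*} [Fintype V] (G : SimpleGraph V) : Set ℝ :=
  {lam : ℝ | ∃ x : V → ℝ, (adjMat G).mulVec x = lam • x ∧ ∑ v, x v ≠ 0}

/-- Combinatorial data of a rooted tree of `k` levels with `c i` children at level `i`. -/
structure TreeData (V : Type*) (k : ℕ) (c : ℕ → ℕ) where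
  r : V
  lev : V → ℕ
  par : V → V
  lev_r : lev r = 0
  lev_zero : ∀ v, lev v = 0 → v = r
  lev_par : ∀ v, v ≠ r → lev v = lev (par v) + 1
  lev_lt : ∀ v, lev v < k
  child : ∀ v, lev v + 1 < k → {w | w ≠ r ∧ par w = v}.ncard = c (lev v)

namespace TreeData

variable {V : Type*} {k : ℕ} {c : ℕ → ℕ}

/-- The graph of a tree data. -/
def G (T : TreeData V k c) : SimpleGraph V where
  Adj v w := (v ≠ T.r ∧ T.par v = w) ∨ (w ≠ T.r ∧ T.par w = v)
  symm := ⟨fun _ _ h => h.symm⟩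
  loopless := ⟨fun v h => by
    rcases h with ⟨h1, h2⟩ | ⟨h1, h2⟩ <;>
    · have := T.lev_par v h1
      rw [h2] at this
      omega⟩

lemma adj_par (T : TreeData V k c) (v : V) (h : v ≠ T.r) : T.G.Adj v (T.par v) :=
  Or.inl ⟨h, rfl⟩

lemma exists_walk (T : TreeData V k c) : ∀ (n : ℕ) (v : V), T.lev v = n →
    ∃ p : T.G.Walk v T.r, p.length = n := by
  intro n
  induction n with
  | zero =>
    intro v hv
    obtain rfl := T.lev_zero v hv
    exact ⟨SimpleGraph.Walk.nil, rfl⟩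
  | succ n ih =>
    intro v hv
    have hr : v ≠ T.r := by
      rintro rfl
      rw [T.lev_r] at hv
      omega
    have h1 := T.lev_par v hr
    obtain ⟨p, hp⟩ := ih (T.par v) (by omega)
    exact ⟨SimpleGraph.Walk.cons (T.adj_par v hr) p, by simp [hp]⟩

lemma lev_adj (T : TreeData V k c) {v w : V} (h : T.G.Adj v w) :
    T.lev v ≤ T.lev w + 1 := by
  rcases h with ⟨h1, h2⟩ | ⟨h1, h2⟩
  · have := T.lev_par v h1
    rw [h2] at this
    omega
  · have := T.lev_par w h1
    rw [h2] at this
    omega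

lemma lev_le_walk (T : TreeData V k c) {v w : V} (p : T.G.Walk v w) :
    T.lev v ≤ T.lev w + p.length := by
  induction p with
  | nil => simp
  | cons h p ih =>
    have := T.lev_adj h
    simp only [SimpleGraph.Walk.length_cons]
    omega

lemma connected (T : TreeData V k c) : T.G.Connected := by
  have : Nonempty V := ⟨T.r⟩
  refine SimpleGraph.Connected.mk ?_
  intro v w
  obtain ⟨p, _⟩ := T.exists_walk _ v rfl
  obtain ⟨q, _⟩ := T.exists_walk _ w rfl
  exact ⟨p.append q.reverse⟩

lemma dist_eq (T : TreeData V k c) (v : V) : T.G.dist T.r v = T.lev v := by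
  rw [SimpleGraph.dist_comm]
  apply le_antisymm
  · obtain ⟨p, hp⟩ := T.exists_walk _ v rfl
    rw [← hp]
    exact SimpleGraph.dist_le p
  · obtain ⟨p, hp⟩ := (T.connected v T.r).exists_walk_length_eq_dist
    have := T.lev_le_walk p
    rw [T.lev_r] at this
    omega

lemma isTree [Finite V] (T : TreeData V k c) : T.G.IsTree := by
  classical
  have := Fintype.ofFinite V
  rw [SimpleGraph.isTree_iff_connected_and_card]
  refine ⟨T.connected, ?_⟩
  apply le_antisymm
  · have hsub : T.G.edgeSet ⊆ Set.image (fun v => s(v, T.par v)) {v | v ≠ T.r} := by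
      intro e
      induction e with
      | _ v w =>
        intro h
        rcases h with ⟨h1, h2⟩ | ⟨h1, h2⟩
        · exact ⟨v, h1, by simp [h2]⟩
        · exact ⟨w, h1, by simp [h2, Sym2.eq_swap]⟩
    have h1 : T.G.edgeSet.ncard ≤ {v | v ≠ T.r}.ncard :=
      (Set.ncard_le_ncard hsub (Set.toFinite _)).trans (Set.ncard_image_le (Set.toFinite _))
    have h2 : {v | v ≠ T.r}.ncard + 1 = Nat.card V := by
      have := Set.ncard_add_ncard_compl ({T.r} : Set V)
      rw [Set.ncard_singleton] at this
      have h3 : ({T.r} : Set V)ᶜ = {v | v ≠ T.r} := by ext; simp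
      rw [h3] at this
      omega
    rw [← h2, Nat.card_coe_set_eq]
    omega
  · exact T.connected.card_vert_le_card_edgeSet_add_one

lemma no_child (T : TreeData V k c) (v : V) (h : T.lev v + 1 = k) :
    {w | w ≠ T.r ∧ T.par w = v} = ∅ := by
  ext w
  simp only [Set.mem_ofPred_eq, Set.mem_empty_iff_false, iff_false, not_and]
  intro h1 h2
  have h3 := T.lev_par w h1
  have h4 := T.lev_lt w
  rw [h2] at h3
  omega

lemma nbr_root (T : TreeData V k c) :
    T.G.neighborSet T.r = {w | w ≠ T.r ∧ T.par w = T.r} := by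
  ext w
  simp [G]

lemma nbr_ncard [Finite V] (T : TreeData V k c) (v : V) (hv : v ≠ T.r) :
    (T.G.neighborSet v).ncard = {w | w ≠ T.r ∧ T.par w = v}.ncard + 1 := by
  have : T.G.neighborSet v = insert (T.par v) {w | w ≠ T.r ∧ T.par w = v} := by
    ext w
    simp only [SimpleGraph.mem_neighborSet, G, Set.mem_insert_iff, Set.mem_ofPred_eq]
    constructor
    · rintro (⟨_, h⟩ | h)
      · exact Or.inl h.symm
      · exact Or.inr h
    · rintro (h | h)
      · exact Or.inl ⟨hv, h.symm⟩
      · exact Or.inr h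
  rw [this, Set.ncard_insert_of_notMem _ (Set.toFinite _)]
  rintro ⟨h1, h2⟩
  have h3 := T.lev_par _ h1
  have h4 := T.lev_par v hv
  rw [h2] at h3
  omega

lemma isGenBetheTree [Finite V] (T : TreeData V k c) (hk : 2 ≤ k) (h0 : 2 ≤ c 0)
    (hc : ∀ i, 1 ≤ c i) :
    IsGenBetheTree T.G T.r k (fun i => if i = 1 then c 0 else c (i - 1) + 1) := by
  refine ⟨T.isTree, ?_, ?_, ?_, ?_⟩
  · intro i _ _
    have := hc (i - 1)
    dsimp only
    split_ifs <;> omega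
  · intro i hi hi2 v hv
    rw [T.dist_eq] at hv
    have hch := T.child v (by omega)
    dsimp only
    split_ifs with h
    · have hv0 : v = T.r := T.lev_zero v (by omega)
      subst hv0
      rw [T.nbr_root, hch, T.lev_r]
    · have hv0 : v ≠ T.r := by
        rintro rfl
        rw [T.lev_r] at hv
        omega
      rw [T.nbr_ncard v hv0, hch, hv]
  · intro v hv
    rw [T.dist_eq] at hv
    have hv0 : v ≠ T.r := by
      rintro rfl
      rw [T.lev_r] at hv
      omega
    rw [T.nbr_ncard v hv0, T.no_child v (by omega)]
    simp
  · intro v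
    rw [T.dist_eq]
    have := T.lev_lt v
    omega

/-- Transport along an equivalence. -/
noncomputable def transport {W : Type*} (T : TreeData V k c) (e : V ≃ W) : TreeData W k c where
  r := e T.r
  lev w := T.lev (e.symm w)
  par w := e (T.par (e.symm w))
  lev_r := by simp [T.lev_r]
  lev_zero := fun v h => by
    rw [← T.lev_zero _ h]
    simp
  lev_par := fun v h => by
    simp only [Equiv.symm_apply_apply]
    apply T.lev_par
    intro h2
    apply h
    rw [← h2]
    simp
  lev_lt := fun v => T.lev_lt _
  child := fun v h => by
    rw [← T.child _ h, ← Set.ncard_image_of_injective _ e.injective]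
    congr 1
    ext w
    simp only [Set.mem_ofPred_eq, Set.mem_image]
    constructor
    · rintro ⟨h1, h2⟩
      refine ⟨e.symm w, ⟨?_, ?_⟩, by simp⟩
      · intro h3
        apply h1
        rw [← h3]
        simp
      · rw [← h2]
        simp
    · rintro ⟨u, ⟨h1, h2⟩, rfl⟩
      refine ⟨by simpa using h1, by simp [h2]⟩

/-- Sum over a level. -/
noncomputable def Z [Fintype V] (T : TreeData V k c) (x : V → ℝ) (i : ℕ) : ℝ :=
  ∑ v with T.lev v = i, x v

lemma Z_k [Fintype V] (T : TreeData V k c) (x : V → ℝ) : T.Z x k = 0 := by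
  unfold Z
  apply Finset.sum_eq_zero
  intro v hv
  have := T.lev_lt v
  simp at hv
  omega

lemma sum_Z [Fintype V] (T : TreeData V k c) (x : V → ℝ) :
    ∑ v, x v = ∑ i ∈ Finset.range k, T.Z x i := by
  unfold Z
  symm
  apply Finset.sum_fiberwise_of_maps_to
  intro v _
  simpa using T.lev_lt v

lemma level_count [Fintype V] [DecidableEq V] (T : TreeData V k c) (i : ℕ) (hi : i < k) (w : V) :
    (∑ v with T.lev v = i, if (v ≠ T.r ∧ T.par v = w) then (1 : ℝ) else 0) =
      if T.lev w + 1 = i then (c (T.lev w) : ℝ) else 0 := by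
  rw [Finset.sum_boole]
  split_ifs with h
  · rw [← T.child w (by omega), Set.ncard_eq_toFinset_card']
    congr 2
    ext v
    simp only [Finset.mem_filter, Finset.mem_univ, true_and, Set.mem_toFinset, Set.mem_ofPred_eq]
    constructor
    · exact fun h => h.2
    · rintro ⟨h1, h2⟩
      refine ⟨?_, h1, h2⟩
      rw [T.lev_par v h1, h2, h]
  · simp only [Nat.cast_eq_zero, Finset.card_eq_zero]
    ext v
    simp only [Finset.mem_filter, Finset.mem_univ, true_and, Finset.notMem_empty, iff_false]
    rintro ⟨h1, h2, h3⟩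
    have := T.lev_par v h2
    rw [h3] at this
    omega

lemma level_count_par [Fintype V] [DecidableEq V] (T : TreeData V k c) (i : ℕ) (w : V) :
    (∑ v with T.lev v = i, if (w ≠ T.r ∧ T.par w = v) then (1 : ℝ) else 0) =
      if T.lev w = i + 1 then (1 : ℝ) else 0 := by
  by_cases hw : w = T.r
  · subst hw
    simp [T.lev_r]
  · have := T.lev_par w hw
    simp only [ne_eq, hw, not_false_eq_true, true_and, Finset.sum_ite_eq, Finset.mem_filter,
      Finset.mem_univ]
    rw [this]
    simp

lemma adj_split [Fintype V] [DecidableEq V] (T : TreeData V k c) (v w : V) :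
    adjMat T.G v w = (if (v ≠ T.r ∧ T.par v = w) then (1 : ℝ) else 0) +
      (if (w ≠ T.r ∧ T.par w = v) then (1 : ℝ) else 0) := by
  unfold adjMat
  simp only [Matrix.of_apply]
  have hG : T.G.Adj v w ↔ (v ≠ T.r ∧ T.par v = w) ∨ (w ≠ T.r ∧ T.par w = v) := Iff.rfl
  by_cases h1 : v ≠ T.r ∧ T.par v = w
  · have h2 : ¬ (w ≠ T.r ∧ T.par w = v) := by
      rintro ⟨h2, h3⟩
      have h4 := T.lev_par v h1.1
      have h5 := T.lev_par w h2
      rw [h1.2] at h4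
      rw [h3] at h5
      omega
    rw [if_pos (hG.2 (Or.inl h1)), if_pos h1, if_neg h2, add_zero]
  · by_cases h2 : w ≠ T.r ∧ T.par w = v
    · rw [if_pos (hG.2 (Or.inr h2)), if_pos h2, if_neg h1, zero_add]
    · rw [if_neg (fun h => (hG.1 h).elim h1 h2), if_neg h2, if_neg h1, zero_add]

lemma Z_rec [Fintype V] (T : TreeData V k c) (x : V → ℝ) (lam : ℝ)
    (hx : (adjMat T.G).mulVec x = lam • x) (i : ℕ) (hi : i < k) :
    lam * T.Z x i = (∑ w, (if T.lev w + 1 = i then (c (T.lev w) : ℝ) else 0) * x w)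
      + T.Z x (i + 1) := by
  classical
  have h1 : lam * T.Z x i = ∑ v with T.lev v = i, (adjMat T.G).mulVec x v := by
    unfold Z
    rw [hx, Finset.mul_sum]
    rfl
  rw [h1]
  simp only [Matrix.mulVec, dotProduct]
  rw [Finset.sum_comm]
  simp only [← Finset.sum_mul, adj_split, Finset.sum_add_distrib, level_count T i hi,
    level_count_par T i, add_mul]
  congr 1
  unfold Z
  rw [Finset.sum_filter]
  apply Finset.sum_congr rfl
  intro w _
  split_ifs <;> simp

lemma Z_rec_zero [Fintype V] (T : TreeData V k c) (x : V → ℝ) (lam : ℝ)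
    (hx : (adjMat T.G).mulVec x = lam • x) (hk : 0 < k) : T.Z x 1 = lam * T.Z x 0 := by
  rw [T.Z_rec x lam hx 0 hk]
  simp

lemma Z_rec_succ [Fintype V] (T : TreeData V k c) (x : V → ℝ) (lam : ℝ)
    (hx : (adjMat T.G).mulVec x = lam • x) (i : ℕ) (hi : i + 1 < k) :
    T.Z x (i + 2) = lam * T.Z x (i + 1) - c i * T.Z x i := by
  rw [T.Z_rec x lam hx (i + 1) hi]
  have : ∑ w, (if T.lev w + 1 = i + 1 then (c (T.lev w) : ℝ) else 0) * x w = c i * T.Z x i := by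
    unfold Z
    rw [Finset.sum_filter, Finset.mul_sum]
    apply Finset.sum_congr rfl
    intro w _
    by_cases h : T.lev w = i
    · simp [h]
    · simp [h]
  rw [this]
  ring

end TreeData

/-- The polynomials of the level-sum recursion. -/
noncomputable def levPoly (c : ℕ → ℕ) : ℕ → Polynomial ℝ
  | 0 => 1
  | 1 => Polynomial.X
  | (i + 2) => Polynomial.X * levPoly c (i + 1) - Polynomial.C (c i : ℝ) * levPoly c i

lemma levPoly_monic (c : ℕ → ℕ) : ∀ i, (levPoly c i).Monic ∧ (levPoly c i).natDegree = i
  | 0 => by simp [levPoly]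
  | 1 => by simp [levPoly, Polynomial.monic_X]
  | (i + 2) => by
    obtain ⟨h1, h2⟩ := levPoly_monic c (i + 1)
    obtain ⟨h3, h4⟩ := levPoly_monic c i
    have hm : (Polynomial.X * levPoly c (i + 1)).Monic := Polynomial.monic_X.mul h1
    have hd : (Polynomial.X * levPoly c (i + 1)).natDegree = i + 2 := by
      rw [Polynomial.monic_X.natDegree_mul h1, h2, Polynomial.natDegree_X]
      ring
    have hlt : (Polynomial.C (c i : ℝ) * levPoly c i).degree
        < (Polynomial.X * levPoly c (i + 1)).degree := by
      rw [Polynomial.degree_eq_natDegree hm.ne_zero, hd]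
      refine lt_of_le_of_lt (Polynomial.degree_le_of_natDegree_le (n := i) ?_) ?_
      · exact (Polynomial.natDegree_C_mul_le _ _).trans h4.le
      · exact_mod_cast (by omega : i < i + 2)
    rw [levPoly]
    refine ⟨hm.sub_of_left hlt, ?_⟩
    rw [← hd]
    exact Polynomial.natDegree_eq_of_degree_eq (Polynomial.degree_sub_eq_left_of_degree_lt hlt)

lemma Z_eq {V : Type*} [Fintype V] {k : ℕ} {c : ℕ → ℕ} (T : TreeData V k c) (x : V → ℝ)
    (lam : ℝ) (hx : (adjMat T.G).mulVec x = lam • x) :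
    ∀ i, i ≤ k → T.Z x i = T.Z x 0 * (levPoly c i).eval lam
  | 0 => fun _ => by simp [levPoly]
  | 1 => fun h => by
    rw [T.Z_rec_zero x lam hx (by omega), levPoly, Polynomial.eval_X]
    ring
  | (i + 2) => fun h => by
    rw [T.Z_rec_succ x lam hx i (by omega), Z_eq T x lam hx (i + 1) (by omega),
      Z_eq T x lam hx i (by omega), levPoly]
    simp only [Polynomial.eval_sub, Polynomial.eval_mul, Polynomial.eval_X, Polynomial.eval_C]
    ring

lemma main_bound {V : Type*} [Fintype V] {k : ℕ} {c : ℕ → ℕ} (T : TreeData V k c)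
    (mu : ℝ) (h1 : (levPoly c k).eval mu = 0)
    (h2 : ∑ i ∈ Finset.range k, (levPoly c i).eval mu = 0) :
    (mainSpectrum T.G).Finite ∧ (mainSpectrum T.G).ncard + 1 ≤ k := by
  classical
  obtain ⟨hm, hd⟩ := levPoly_monic c k
  have hsub : insert mu (mainSpectrum T.G) ⊆ ((levPoly c k).roots.toFinset : Set ℝ) := by
    intro lam hl
    simp only [Finset.mem_coe, Multiset.mem_toFinset, Polynomial.mem_roots hm.ne_zero,
      Polynomial.IsRoot.def]
    rcases hl with rfl | ⟨x, hx, hs⟩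
    · exact h1
    · have hk := Z_eq T x lam hx k le_rfl
      rw [T.Z_k] at hk
      rcases mul_eq_zero.1 hk.symm with h0 | h0
      · exfalso
        apply hs
        rw [T.sum_Z]
        apply Finset.sum_eq_zero
        intro i hi
        rw [Z_eq T x lam hx i (Finset.mem_range.1 hi).le, h0, zero_mul]
      · exact h0
  have hnot : mu ∉ mainSpectrum T.G := by
    rintro ⟨x, hx, hs⟩
    apply hs
    rw [T.sum_Z, Finset.sum_congr rfl
      (fun i hi => Z_eq T x mu hx i (Finset.mem_range.1 hi).le), ← Finset.mul_sum, h2, mul_zero]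
  have hfin : (mainSpectrum T.G).Finite :=
    (Finset.finite_toSet _).subset ((Set.subset_insert _ _).trans hsub)
  refine ⟨hfin, ?_⟩
  rw [← Set.ncard_insert_of_notMem hnot hfin]
  calc _ ≤ ((levPoly c k).roots.toFinset : Set ℝ).ncard :=
        Set.ncard_le_ncard hsub (Finset.finite_toSet _)
    _ = (levPoly c k).roots.toFinset.card := Set.ncard_coe_finset _
    _ ≤ Multiset.card (levPoly c k).roots := Multiset.toFinset_card_le _
    _ ≤ (levPoly c k).natDegree := Polynomial.card_roots' _
    _ = k := hd

/-- Size of level `i`. -/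
def levSize (c : ℕ → ℕ) (i : ℕ) : ℕ := ∏ j ∈ Finset.range i, c j

/-- Vertices: pairs (level, index). -/
abbrev TV (k : ℕ) (c : ℕ → ℕ) : Type := Σ i : Fin k, Fin (levSize c i)

lemma tv_ext {k : ℕ} {c : ℕ → ℕ} {v w : TV k c} (h1 : (v.1 : ℕ) = w.1) (h2 : (v.2 : ℕ) = w.2) :
    v = w := by
  obtain ⟨⟨i, hi⟩, ⟨a, ha⟩⟩ := v
  obtain ⟨⟨j, hj⟩, ⟨b, hb⟩⟩ := w
  simp only at h1 h2
  subst h1 h2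
  rfl

lemma par_lt {c : ℕ → ℕ} {i a : ℕ} (h : i ≠ 0) (ha : a < levSize c i) :
    a / c (i - 1) < levSize c (i - 1) := by
  obtain ⟨j, rfl⟩ := Nat.exists_eq_succ_of_ne_zero h
  simp only [levSize, Nat.succ_eq_add_one, Finset.prod_range_succ, Nat.add_sub_cancel] at ha ⊢
  exact Nat.div_lt_of_lt_mul (by rwa [mul_comm])

/-- The standard tree data. -/
noncomputable def stdTree (k : ℕ) (c : ℕ → ℕ) (hk : 0 < k) (hc : ∀ i, 1 ≤ c i) :
    TreeData (TV k c) k c where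
  r := ⟨⟨0, hk⟩, ⟨0, by simp [levSize]⟩⟩
  lev v := v.1
  par v := if h : (v.1 : ℕ) = 0 then v else
    ⟨⟨v.1 - 1, by omega⟩, ⟨v.2 / c (v.1 - 1), par_lt h v.2.2⟩⟩
  lev_r := rfl
  lev_zero := fun v h => by
    apply tv_ext h
    have := v.2.2
    simp only [levSize, h, Finset.range_zero, Finset.prod_empty] at this
    dsimp only
    omega
  lev_par := fun v h => by
    have h0 : (v.1 : ℕ) ≠ 0 := by
      intro h0
      apply h
      apply tv_ext h0
      have := v.2.2
      simp only [levSize, h0, Finset.range_zero, Finset.prod_empty] at this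
      dsimp only
      omega
    simp only [h0, dite_false]
    omega
  lev_lt := fun v => v.1.2
  child := fun v h => by
    have hlt : ∀ t : Fin (c v.1), (v.2 : ℕ) * c v.1 + t < levSize c (v.1 + 1) := by
      intro t
      have h1 := v.2.2
      have h2 := t.2
      have h3 : levSize c (v.1 + 1) = levSize c v.1 * c v.1 := Finset.prod_range_succ _ _
      rw [h3]
      calc (v.2 : ℕ) * c v.1 + t < (v.2 : ℕ) * c v.1 + c v.1 := by omega
        _ = (v.2 + 1) * c v.1 := by ring
        _ ≤ _ := Nat.mul_le_mul_right _ h1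
    let f : Fin (c v.1) → TV k c := fun t => ⟨⟨v.1 + 1, h⟩, ⟨v.2 * c v.1 + t, hlt t⟩⟩
    have hf : Function.Injective f := by
      intro s t hst
      have h1 : ((f s).2 : ℕ) = (f t).2 := by rw [hst]
      simp only [f] at h1
      ext
      omega
    have hset : {w : TV k c | w ≠ (⟨⟨0, hk⟩, ⟨0, by simp [levSize]⟩⟩ : TV k c) ∧
        (if h : (w.1 : ℕ) = 0 then w else
        ⟨⟨w.1 - 1, by omega⟩, ⟨w.2 / c (w.1 - 1), par_lt h w.2.2⟩⟩) = v} = Set.range f := by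
      ext w
      simp only [Set.mem_ofPred_eq, Set.mem_range]
      constructor
      · rintro ⟨h1, h2⟩
        have h0 : (w.1 : ℕ) ≠ 0 := by
          intro h0
          apply h1
          apply tv_ext h0
          have := w.2.2
          simp only [levSize, h0, Finset.range_zero, Finset.prod_empty] at this
          dsimp only
          omega
        rw [dif_neg h0] at h2
        have e1 : (w.1 : ℕ) - 1 = v.1 := by rw [← h2]
        have e2 : (w.2 : ℕ) / c (w.1 - 1) = v.2 := by
          rw [← h2]
        rw [e1] at e2
        refine ⟨⟨w.2 % c v.1, Nat.mod_lt _ (hc _)⟩, ?_⟩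
        apply tv_ext
        · simp only [f]
          omega
        · simp only [f]
          rw [← e2]
          exact Nat.div_add_mod' _ _
      · rintro ⟨t, rfl⟩
        refine ⟨?_, ?_⟩
        · intro h1
          have h2 := congrArg (fun u : TV k c => (u.1 : ℕ)) h1
          simp [f] at h2
        · rw [dif_neg (by simp [f])]
          apply tv_ext
          · simp [f]
          · simp only [f, Nat.add_sub_cancel]
            rw [mul_comm, Nat.mul_add_div (hc _), Nat.div_eq_of_lt t.2, add_zero]
    rw [hset, ← Set.image_univ, Set.ncard_image_of_injective _ hf, Set.ncard_univ]
    simp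

lemma finish (k : ℕ) (c : ℕ → ℕ) (hk : 2 ≤ k) (h0 : 2 ≤ c 0) (hc : ∀ i, 1 ≤ c i) (mu : ℝ)
    (h1 : (levPoly c k).eval mu = 0)
    (h2 : ∑ i ∈ Finset.range k, (levPoly c i).eval mu = 0) :
    ∃ (n : ℕ) (G : SimpleGraph (Fin n)) (r : Fin n) (d : ℕ → ℕ),
      IsGenBetheTree G r k d ∧ (mainSpectrum G).Finite ∧
        (mainSpectrum G).ncard ≤ k - 1 ∧ (mainSpectrum G).ncard < k := by
  let T := (stdTree k c (by omega) hc).transport (Fintype.equivFin _)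
  obtain ⟨h3, h4⟩ := main_bound T mu h1 h2
  exact ⟨_, T.G, T.r, _, T.isGenBetheTree hk h0 hc, h3, by omega, by omega⟩

lemma eval_extend (c : ℕ → ℕ) (k0 : ℕ) (hc : ∀ i, k0 ≤ i → c i = 1)
    (h1 : (levPoly c (k0 + 1)).eval 1 = 0)
    (h2 : ∑ i ∈ Finset.range (k0 + 1), (levPoly c i).eval 1 = 0) (m : ℕ) :
    (levPoly c (k0 + 6 * m + 1)).eval 1 = 0 ∧
      ∑ i ∈ Finset.range (k0 + 6 * m + 1), (levPoly c i).eval 1 = 0 := by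
  induction m with
  | zero => exact ⟨h1, h2⟩
  | succ m ih =>
    obtain ⟨ha, hb⟩ := ih
    have hr : ∀ j, k0 ≤ j → (levPoly c (j + 2)).eval 1
        = (levPoly c (j + 1)).eval 1 - (levPoly c j).eval 1 := by
      intro j hj
      rw [levPoly, hc j hj]
      simp
    set n := k0 + 6 * m with hn
    have e : k0 + 6 * (m + 1) + 1 = n + 7 := by omega
    have r0 := hr n (by omega)
    have r1 := hr (n + 1) (by omega)
    have r2 := hr (n + 2) (by omega)
    have r3 := hr (n + 3) (by omega)
    have r4 := hr (n + 4) (by omega)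
    have r5 := hr (n + 5) (by omega)
    simp only [add_assoc, Nat.reduceAdd] at r0 r1 r2 r3 r4 r5
    rw [e]
    refine ⟨by linarith, ?_⟩
    simp only [Finset.sum_range_succ _ (n + 6), Finset.sum_range_succ _ (n + 5),
      Finset.sum_range_succ _ (n + 4), Finset.sum_range_succ _ (n + 3),
      Finset.sum_range_succ _ (n + 2), Finset.sum_range_succ _ (n + 1), hb]
    linarith

/-- Children sequence from a list, continued by ones. -/
def seqOf (l : List ℕ) (i : ℕ) : ℕ := l.getD i 1

lemma seqOf_large (l : List ℕ) (i : ℕ) (h : l.length ≤ i) : seqOf l i = 1 := by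
  simp [seqOf, h]

lemma seqOf_pos (l : List ℕ) (hl : ∀ a ∈ l, 1 ≤ a) (i : ℕ) : 1 ≤ seqOf l i := by
  by_cases h : i < l.length
  · have : seqOf l i = l[i] := by simp [seqOf, h]
    rw [this]
    exact hl _ (List.getElem_mem h)
  · rw [seqOf_large l i (by omega)]

lemma finish_list (l : List ℕ) (hl : ∀ a ∈ l, 1 ≤ a) (h0 : 2 ≤ seqOf l 0) (hl0 : 1 ≤ l.length)
    (h1 : (levPoly (seqOf l) (l.length + 1)).eval 1 = 0)
    (h2 : ∑ i ∈ Finset.range (l.length + 1), (levPoly (seqOf l) i).eval 1 = 0) (m : ℕ) :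
    ∃ (n : ℕ) (G : SimpleGraph (Fin n)) (r : Fin n) (d : ℕ → ℕ),
      IsGenBetheTree G r (l.length + 6 * m + 1) d ∧ (mainSpectrum G).Finite ∧
        (mainSpectrum G).ncard ≤ (l.length + 6 * m + 1) - 1 ∧
        (mainSpectrum G).ncard < l.length + 6 * m + 1 := by
  obtain ⟨h3, h4⟩ := eval_extend (seqOf l) l.length (seqOf_large l) h1 h2 m
  exact finish _ (seqOf l) (by omega) h0 (seqOf_pos l hl) 1 h3 h4

/-- For every even `k ≥ 6` there is a generalized Bethe tree with `k`
levels having fewer than `k` (indeed at most `k - 1`) main eigenvalues; hence the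
conjecture that every generalized Bethe tree with an even number of levels `k` has
exactly `k` main eigenvalues fails for every even `k ≥ 6`. -/
theorem conjecture_fails (k : ℕ) (hk : Even k) (hk6 : 6 ≤ k) :
    ∃ (n : ℕ) (G : SimpleGraph (Fin n)) (r : Fin n) (d : ℕ → ℕ),
      IsGenBetheTree G r k d ∧ (mainSpectrum G).Finite ∧
        (mainSpectrum G).ncard ≤ k - 1 ∧ (mainSpectrum G).ncard < k := by
  have hcases : ∃ m, k = 5 + 6 * m + 1 ∨ k = 7 + 6 * m + 1 ∨ k = 9 + 6 * m + 1 := by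
    obtain ⟨j, rfl⟩ := hk
    exact ⟨(j + j - 6) / 6, by omega⟩
  obtain ⟨m, rfl | rfl | rfl⟩ := hcases
  · exact finish_list [5, 3, 2, 1, 8] (by simp) (by simp [seqOf]) (by simp)
      (by simp [levPoly, seqOf]; norm_num)
      (by simp [levPoly, seqOf, Finset.sum_range_succ]; norm_num) m
  · exact finish_list [2, 1, 5, 1, 2, 1, 6] (by simp) (by simp [seqOf]) (by simp)
      (by simp [levPoly, seqOf]; norm_num)
      (by simp [levPoly, seqOf, Finset.sum_range_succ]; norm_num) m
  · exact finish_list [2, 1, 1, 1, 2, 1, 1, 1, 3] (by simp) (by simp [seqOf]) (by simp)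
      (by simp [levPoly, seqOf]; norm_num)
      (by simp [levPoly, seqOf, Finset.sum_range_succ]; norm_num) m
end

section
/- For any integers k ≥ 3 and d ≥ 2, the quasi-regular complete tree Q_{d,k} has exactly k main eigenvalues; that is, the set of main eigenvalues of Q_{d,k} has cardinality exactly k. -/
open Matrix Finset

/-- In a tree every vertex other than the root has a unique parent. -/
lemma bethe_parent {V : Type*} (G : SimpleGraph V) (r : V) (hG : G.IsTree) (v : V)
    (hv : 1 ≤ G.dist r v) :
    ∃ u, G.Adj v u ∧ G.dist r u + 1 = G.dist r v ∧
      ∀ w, G.Adj v w → w ≠ u → G.dist r w = G.dist r v + 1 := by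
  have hne : v ≠ r := by
    rintro rfl
    simp at hv
  obtain ⟨p, hp, hpl⟩ := hG.connected.exists_path_of_dist v r
  have hnn : ¬ p.Nil := fun h => hne h.eq
  have hadj : G.Adj v p.snd := p.adj_snd hnn
  have key : ∀ w, G.Adj v w → G.dist r w + 1 = G.dist r v → w = p.snd := by
    intro w hw hd
    obtain ⟨q, hq, hql⟩ := hG.connected.exists_path_of_dist w r
    have hl : (SimpleGraph.Walk.cons hw q).length = G.dist v r := by
      rw [SimpleGraph.Walk.length_cons, hql, SimpleGraph.dist_comm, hd, SimpleGraph.dist_comm]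
    have hqp := (SimpleGraph.Walk.cons hw q).isPath_of_length_eq_dist hl
    have := (hG.existsUnique_path v r).unique hp hqp
    rw [this]
    simp
  refine ⟨p.snd, hadj, ?_, ?_⟩
  · have h1 : G.dist p.snd r ≤ p.tail.length := G.dist_le _
    have h2 := SimpleGraph.Walk.length_tail_add_one hnn
    rw [SimpleGraph.dist_comm (u := r) (v := v), ← hpl]
    rcases hG.dist_eq_dist_add_one_of_adj r hadj with h | h
    · rw [SimpleGraph.dist_comm (u := v)] at hpl
      omega
    · rw [SimpleGraph.dist_comm (u := v)] at hpl
      rw [SimpleGraph.dist_comm] at h1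
      omega
  · intro w hw hwu
    rcases hG.dist_eq_dist_add_one_of_adj r hw with h | h
    · exact absurd (key w hw h.symm) hwu
    · exact h

lemma bethe_mulVec {V : Type*} [Fintype V] (G : SimpleGraph V) (r : V) (hG : G.IsTree)
    (F : ℕ → ℝ) (v : V) :
    (adjMat G).mulVec (fun w => F (G.dist r w)) v =
      if G.dist r v = 0 then ((G.neighborSet v).ncard : ℝ) * F 1
      else F (G.dist r v - 1) + (((G.neighborSet v).ncard : ℝ) - 1) * F (G.dist r v + 1) := by
  classical
  have h0 : (adjMat G).mulVec (fun w => F (G.dist r w)) v =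
      ∑ w ∈ G.neighborFinset v, F (G.dist r w) := by
    simp [Matrix.mulVec, dotProduct, adjMat, SimpleGraph.neighborFinset_eq_filter,
      Finset.sum_filter]
  have hc : (G.neighborSet v).ncard = (G.neighborFinset v).card := by
    rw [SimpleGraph.neighborFinset, Set.ncard_eq_toFinset_card']
  rw [h0, hc]
  split_ifs with h
  · have hrv : r = v := hG.connected.dist_eq_zero_iff.1 h
    subst hrv
    rw [Finset.sum_congr rfl (g := fun _ => F 1), Finset.sum_const, nsmul_eq_mul]
    intro w hw
    rw [SimpleGraph.dist_eq_one_iff_adj.2 (by simpa using hw)]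
  · obtain ⟨u, hu, hdu, hw⟩ := bethe_parent G r hG v (by omega)
    have hmem : u ∈ G.neighborFinset v := by simpa using hu
    rw [← Finset.add_sum_erase _ _ hmem]
    rw [Finset.sum_congr rfl (g := fun _ => F (G.dist r v + 1)), Finset.sum_const, nsmul_eq_mul,
      Finset.card_erase_of_mem hmem, Nat.cast_sub (Finset.card_pos.2 ⟨u, hmem⟩)]
    · rw [← hdu]; simp
    · intro w hw'
      rw [Finset.mem_erase] at hw'
      rw [hw w (by simpa using hw'.2) hw'.1]

lemma bethe_surj {V : Type*} [Fintype V] (G : SimpleGraph V) (r : V) (k d : ℕ)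
    (hd : 2 ≤ d) (hT : IsGenBetheTree G r k (fun _ => d)) (j : ℕ) (hj : j ≤ k - 1) :
    ∃ v, G.dist r v = j := by
  obtain ⟨hG, -, hdeg, -, -⟩ := hT
  induction j with
  | zero => exact ⟨r, by simp⟩
  | succ j ih =>
    obtain ⟨v, hv⟩ := ih (by omega)
    have hn := hdeg (j + 1) (by omega) hj v (by simpa using hv)
    simp only at hn
    obtain ⟨a, ha, b, hb, hab⟩ := Set.one_lt_ncard_iff_nontrivial.1 (show 1 < _ by rw [hn]; exact hd)
    rcases Nat.eq_zero_or_pos j with h | h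
    · subst h
      have hrv : r = v := hG.connected.dist_eq_zero_iff.1 hv
      subst hrv
      exact ⟨a, SimpleGraph.dist_eq_one_iff_adj.2 ha⟩
    · obtain ⟨u, hu, hdu, hw⟩ := bethe_parent G r hG v (by omega)
      by_cases hau : a = u
      · exact ⟨b, by rw [hw b hb (by rintro rfl; exact hab hau), hv]⟩
      · exact ⟨a, by rw [hw a ha hau, hv]⟩

/-- A radial eigenvector with vanishing value at the leaves is zero. -/
lemma bethe_zero {V : Type*} [Fintype V] (G : SimpleGraph V) (r : V) (k d : ℕ) (hk : 3 ≤ k)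
    (hd : 2 ≤ d) (hT : IsGenBetheTree G r k (fun _ => d)) (F : ℕ → ℝ) (lam : ℝ)
    (hF : (adjMat G).mulVec (fun w => F (G.dist r w)) = lam • (fun w => F (G.dist r w)))
    (hleaf : F (k - 1) = 0) : ∀ v, F (G.dist r v) = 0 := by
  have hs := bethe_surj G r k d hd hT
  obtain ⟨hG, -, hdeg, hl, hle⟩ := hT
  have main : ∀ i, i + 1 ≤ k - 1 → F (k - 1 - i) = 0 ∧ F (k - 1 - (i + 1)) = 0 := by
    intro i
    induction i with
    | zero =>
      intro _
      refine ⟨hleaf, ?_⟩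
      obtain ⟨v, hv⟩ := hs (k - 1) le_rfl
      have := congrFun hF v
      rw [bethe_mulVec G r hG, if_neg (by omega), hl v hv] at this
      simp only [Pi.smul_apply, hv, hleaf, smul_eq_mul] at this
      simpa using this
    | succ i ih =>
      intro hi
      obtain ⟨h1, h2⟩ := ih (by omega)
      refine ⟨h2, ?_⟩
      obtain ⟨v, hv⟩ := hs (k - 1 - (i + 1)) (by omega)
      have := congrFun hF v
      rw [bethe_mulVec G r hG, if_neg (by omega)] at this
      simp only [Pi.smul_apply, hv, h2, smul_eq_mul] at this
      rw [show k - 1 - (i + 1) + 1 = k - 1 - i by omega, h1] at this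
      simpa [show k - 1 - (i + 1) - 1 = k - 1 - (i + 1 + 1) by omega] using this
  intro v
  have hv := hle v
  rcases Nat.lt_or_ge 0 (G.dist r v) with h | h
  · have := (main (k - 1 - G.dist r v) (by omega)).1
    rwa [show k - 1 - (k - 1 - G.dist r v) = G.dist r v by omega] at this
  · have := (main (k - 2) (by omega)).2
    rwa [show k - 1 - (k - 2 + 1) = G.dist r v by omega] at this

lemma bethe_sum {V : Type*} [Fintype V] (G : SimpleGraph V) (r : V) (k d : ℕ) (hk : 3 ≤ k)
    (hd : 2 ≤ d) (hT : IsGenBetheTree G r k (fun _ => d)) (F : ℕ → ℝ) (lam : ℝ)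
    (hF : (adjMat G).mulVec (fun w => F (G.dist r w)) = lam • (fun w => F (G.dist r w)))
    (hsum : ∑ v, F (G.dist r v) = 0) : F (k - 1) = 0 := by
  classical
  have hs := bethe_surj G r k d hd hT
  obtain ⟨hG, -, hdeg, hl, hle⟩ := hT
  have hcol : ∀ w, ∑ v, adjMat G v w = (d : ℝ) - if G.dist r w = k - 1 then (d : ℝ) - 1 else 0 := by
    intro w
    have h1 : ∑ v, adjMat G v w = ((G.neighborSet w).ncard : ℝ) := by
      rw [Set.ncard_eq_toFinset_card']
      simp only [adjMat, Matrix.of_apply, Finset.sum_boole, G.adj_comm _ w]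
      congr 2
      ext x
      simp
    rw [h1]
    split_ifs with h
    · rw [hl w h]; simp
    · have := hle w
      rw [hdeg (G.dist r w + 1) (by omega) (by omega) w (by simp)]; simp
  have h1 : ∑ v, (adjMat G).mulVec (fun w => F (G.dist r w)) v = 0 := by
    rw [hF]
    simp [← Finset.mul_sum, hsum]
  simp only [Matrix.mulVec, dotProduct] at h1
  rw [Finset.sum_comm] at h1
  simp only [← Finset.sum_mul, hcol, sub_mul, Finset.sum_sub_distrib, ← Finset.mul_sum, hsum] at h1
  have h2 : ∑ w, (if G.dist r w = k - 1 then (d : ℝ) - 1 else 0) * F (G.dist r w) =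
      (#{w | G.dist r w = k - 1} : ℝ) * (((d : ℝ) - 1) * F (k - 1)) := by
    rw [← nsmul_eq_mul, ← Finset.sum_const, Finset.sum_filter]
    refine Finset.sum_congr rfl fun w _ => ?_
    split_ifs with h
    · rw [h]
    · simp
  rw [h2] at h1
  obtain ⟨v, hv⟩ := hs (k - 1) le_rfl
  have h3 : (#{w | G.dist r w = k - 1} : ℝ) ≠ 0 := by
    have : 0 < #{w | G.dist r w = k - 1} := Finset.card_pos.2 ⟨v, by simp [hv]⟩
    exact_mod_cast this.ne'
  have h4 : (d : ℝ) - 1 ≠ 0 := by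
    have : (2 : ℝ) ≤ d := by exact_mod_cast hd
    linarith
  have h5 : (#{w | G.dist r w = k - 1} : ℝ) * (((d : ℝ) - 1) * F (k - 1)) = 0 := by linarith
  simpa [h3, h4] using h5

/-- The linear map sending a function of the level to the radial vector. -/
noncomputable def betheRadial {V : Type*} [Fintype V] (k : ℕ) (lev : V → Fin k) :
    (Fin k → ℝ) →ₗ[ℝ] EuclideanSpace ℝ V where
  toFun f := WithLp.toLp 2 (fun v => f (lev v))
  map_add' f g := by ext v; simp
  map_smul' c f := by ext v; simp

/-- For `k ≥ 3` and `d ≥ 2`, the quasi-regular complete tree `Q_{d,k}` (the generalized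
Bethe tree with `k` levels and `d₁ = d₂ = ⋯ = d_{k-1} = d`) has exactly `k`
main eigenvalues. -/
theorem quasiRegularTree_main_eigenvalues {V : Type*} [Fintype V] (G : SimpleGraph V) (r : V)
    (k d : ℕ) (hk : 3 ≤ k) (hd : 2 ≤ d)
    (hT : IsGenBetheTree G r k (fun _ => d)) :
    (mainSpectrum G).Finite ∧ (mainSpectrum G).ncard = k := by
  classical
  have hle : ∀ v, G.dist r v < k := fun v => by
    have := hT.2.2.2.2 v
    omega
  let lev : V → Fin k := fun v => ⟨G.dist r v, hle v⟩
  have hsurj : Function.Surjective lev := by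
    intro j
    obtain ⟨v, hv⟩ := bethe_surj G r k d hd hT j (by omega)
    exact ⟨v, Fin.ext hv⟩
  let W := LinearMap.range (betheRadial k lev)
  have memW : ∀ x : EuclideanSpace ℝ V, x ∈ W ↔ ∃ F : ℕ → ℝ, ∀ v, x v = F (G.dist r v) := by
    intro x
    constructor
    · rintro ⟨f, rfl⟩
      refine ⟨fun j => if h : j < k then f ⟨j, h⟩ else 0, fun v => ?_⟩
      simp [hle v, betheRadial, lev]
    · rintro ⟨F, hF⟩
      refine ⟨fun j => F j, ?_⟩
      ext v
      simp [betheRadial, lev, hF]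
  have hinj : Function.Injective (betheRadial k lev) := by
    intro f g hfg
    funext j
    obtain ⟨v, rfl⟩ := hsurj j
    have := congrArg (fun x : EuclideanSpace ℝ V => x v) hfg
    simpa [betheRadial] using this
  have hfin : Module.finrank ℝ W = k := by
    rw [LinearMap.finrank_range_of_inj hinj]
    simp
  let T : EuclideanSpace ℝ V →ₗ[ℝ] EuclideanSpace ℝ V := (adjMat G).toEuclideanLin
  have hTapp : ∀ x v, T x v = (adjMat G).mulVec (fun w => x w) v := fun x v => rfl
  have hsym : T.IsSymmetric := by
    rw [Matrix.isSymmetric_toEuclideanLin_iff]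
    ext v w
    simp [adjMat, SimpleGraph.adj_comm]
  have hinv : ∀ x ∈ W, T x ∈ W := by
    intro x hx
    obtain ⟨F, hF⟩ := (memW x).1 hx
    rw [memW]
    refine ⟨fun j => if j = 0 then (d : ℝ) * F 1 else
      F (j - 1) + ((if j = k - 1 then 1 else (d : ℝ)) - 1) * F (j + 1), fun v => ?_⟩
    rw [hTapp]
    simp only [hF]
    rw [bethe_mulVec G r hT.1]
    have hv := hle v
    by_cases h : G.dist r v = k - 1
    · rw [hT.2.2.2.1 v h]
      simp [h, show k - 1 ≠ 0 by omega]
    · rw [hT.2.2.1 (G.dist r v + 1) (by omega) (by omega) v (by simp)]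
      simp [h]
  have hS := hsym.restrict_invariant hinv
  set S : W →ₗ[ℝ] W := T.restrict hinv with hSdef
  -- eigenvectors of S
  have heig : ∀ (x : W) (μ : ℝ), S x = μ • x → ∃ F : ℕ → ℝ,
      (∀ v, (x : EuclideanSpace ℝ V) v = F (G.dist r v)) ∧
      (adjMat G).mulVec (fun w => F (G.dist r w)) = μ • (fun w => F (G.dist r w)) := by
    intro x μ hx
    obtain ⟨F, hF⟩ := (memW x).1 x.2
    refine ⟨F, hF, ?_⟩
    have h1 : T (x : EuclideanSpace ℝ V) = μ • (x : EuclideanSpace ℝ V) := by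
      have := congrArg Subtype.val hx
      simpa [hSdef] using this
    funext v
    have h2 := congrArg (fun y : EuclideanSpace ℝ V => y v) h1
    simp only [hTapp, hF] at h2
    rw [h2]
    simp [hF]
  obtain ⟨vl, hvl⟩ := bethe_surj G r k d hd hT (k - 1) le_rfl
  have hzero : ∀ (x : W) (μ : ℝ), S x = μ • x → (x : EuclideanSpace ℝ V) vl = 0 → x = 0 := by
    intro x μ hx h0
    obtain ⟨F, hF, hF'⟩ := heig x μ hx
    rw [hF, hvl] at h0
    have := bethe_zero G r k d hk hd hT F μ hF' h0
    ext v
    simp [hF, this]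
  have hspec : mainSpectrum G = Set.range (hS.eigenvalues hfin) := by
    ext μ
    constructor
    · rintro ⟨x, hx, hxs⟩
      by_contra hμ
      have hne : ¬ Module.End.HasEigenvalue S μ := by
        intro h
        obtain ⟨i, hi⟩ := hS.exists_eigenvalues_eq hfin h
        exact hμ ⟨i, by simpa using hi⟩
      have hinjS : Function.Injective (S - μ • LinearMap.id : W →ₗ[ℝ] W) := by
        rw [injective_iff_map_eq_zero]
        intro y hy
        by_contra hy0
        apply hne
        refine Module.End.hasEigenvalue_of_hasEigenvector (x := y) ⟨?_, hy0⟩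
        rw [Module.End.mem_eigenspace_iff]
        simpa [sub_eq_zero] using hy
      have hsurjS := LinearMap.injective_iff_surjective.1 hinjS
      obtain ⟨y, hy⟩ := hsurjS ⟨WithLp.toLp 2 (fun _ => (1 : ℝ)), (memW _).2 ⟨fun _ => 1, fun _ => rfl⟩⟩
      have hy' : T (y : EuclideanSpace ℝ V) - μ • (y : EuclideanSpace ℝ V) =
          WithLp.toLp 2 (fun _ => (1 : ℝ)) := by
        have := congrArg Subtype.val hy
        simpa [hSdef] using this
      have hTx : T (WithLp.toLp 2 x) = μ • WithLp.toLp 2 x := by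
        ext v
        rw [hTapp]
        simpa using congrFun hx v
      apply hxs
      have h1 : inner ℝ (WithLp.toLp 2 x) (WithLp.toLp 2 (fun _ : V => (1 : ℝ))) = ∑ v, x v := by
        simp [PiLp.inner_apply]
      rw [← h1, ← hy', inner_sub_right, ← hsym, hTx, inner_smul_left, inner_smul_right]
      simp
    · rintro ⟨i, rfl⟩
      have hb := hS.apply_eigenvectorBasis hfin i
      set b := hS.eigenvectorBasis hfin with hbdef
      obtain ⟨F, hF, hF'⟩ := heig (b i) _ hb
      refine ⟨_, hF', fun hs => ?_⟩
      have h0 := bethe_sum G r k d hk hd hT F _ hF' hs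
      have : b i = 0 := hzero _ _ hb (by rw [hF, hvl, h0])
      exact b.toBasis.ne_zero i (by simpa using this)
  have hei : Function.Injective (hS.eigenvalues hfin) := by
    intro i j hij
    by_contra hne
    have hbi := hS.apply_eigenvectorBasis hfin i
    have hbj := hS.apply_eigenvectorBasis hfin j
    rw [← hij] at hbj
    set b := hS.eigenvectorBasis hfin with hbdef
    set ci := (b i : EuclideanSpace ℝ V) vl with hci
    set cj := (b j : EuclideanSpace ℝ V) vl with hcj
    have hz : cj • b i - ci • b j = 0 := by
      refine hzero _ (hS.eigenvalues hfin i) ?_ ?_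
      · rw [map_sub, map_smul, map_smul, hbi, hbj, smul_sub, smul_comm cj, smul_comm ci]
        rfl
      · simp [← hci, ← hcj]
        ring
    have hci0 : ci ≠ 0 := by
      intro h
      exact b.toBasis.ne_zero i (by simpa using hzero _ _ hbi h)
    have h1 : inner ℝ (b j) (cj • b i - ci • b j) = (0 : ℝ) := by rw [hz, inner_zero_right]
    rw [inner_sub_right, inner_smul_right, inner_smul_right,
      b.inner_eq_zero (Ne.symm hne), b.inner_eq_one] at h1
    apply hci0
    linarith
  rw [hspec]
  refine ⟨Set.finite_range _, ?_⟩
  rw [← Set.image_univ, Set.ncard_image_of_injective _ hei, Set.ncard_univ]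
  simp
end
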